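/- For every u ∈ ℤ³ and every p ≥ 0 there exists an enumeration u₁, u₂, …, u_{4ᵖ} of the support of e⁽ᵖ⁾_u such that for every t = 1, …, 4ᵖ the partial sum f_t = δ_{u₁} + ⋯ + δ_{u_t} satisfies: the support of σ(f_t) has at most 4p + 4 elements and contains u. (In particular, the level-p pyramid can be built from the vacuum by single-qubit errors while never having more than 4p + 4 defects, with a defect present at the apex after every step.) -/

import Mathlib

open Finsupp

namespace BH

/-- The `𝔽₂`-vector space of finitely supported functions `ℤ³ → 𝔽₂`. -/
abbrev V3 := (Fin 3 → ℤ) →₀ ZMod 2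

/-- The coordinate unit vector `x̂`. -/
def xhat : Fin 3 → ℤ := ![1, 0, 0]

/-- The coordinate unit vector `ŷ`. -/
def yhat : Fin 3 → ℤ := ![0, 1, 0]

/-- The coordinate unit vector `ẑ`. -/
def zhat : Fin 3 → ℤ := ![0, 0, 1]

/-- The indicator function `δ_u`. -/
noncomputable def δ (u : Fin 3 → ℤ) : V3 := Finsupp.single u 1

/-- The fractal error: `e⁽⁰⁾_u = δ_u` and
`e⁽ᵖ⁺¹⁾_u = e⁽ᵖ⁾_u + e⁽ᵖ⁾_{u+2ᵖx̂} + e⁽ᵖ⁾_{u+2ᵖŷ} + e⁽ᵖ⁾_{u+2ᵖẑ}`. -/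
noncomputable def e : ℕ → (Fin 3 → ℤ) → V3
  | 0, u => δ u
  | p + 1, u =>
      e p u + e p (u + (2 ^ p : ℤ) • xhat) + e p (u + (2 ^ p : ℤ) • yhat)
        + e p (u + (2 ^ p : ℤ) • zhat)

/-- The syndrome map `σ` of Code 1 restricted to `X`-errors on first qubits:
the `𝔽₂`-linear map with `σ(δ_u) = δ_u + δ_{u+x̂} + δ_{u+ŷ} + δ_{u+ẑ}`. -/
noncomputable def σmap (f : V3) : V3 :=
  f + Finsupp.mapDomain (· + xhat) f + Finsupp.mapDomain (· + yhat) f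
    + Finsupp.mapDomain (· + zhat) f

/-- The level-`p` pyramid with apex `c`: the four defects at
`c, c+2ᵖx̂, c+2ᵖŷ, c+2ᵖẑ`. -/
noncomputable def pyr (p : ℕ) (c : Fin 3 → ℤ) : V3 :=
  δ c + δ (c + (2 ^ p : ℤ) • xhat) + δ (c + (2 ^ p : ℤ) • yhat)
    + δ (c + (2 ^ p : ℤ) • zhat)

end BH

namespace BH

/-- Order in which the errors are created. -/
def L : ℕ → (Fin 3 → ℤ) → List (Fin 3 → ℤ)
  | 0, u => [u]
  | p + 1, u =>
      L p u ++ (L p (u + (2 ^ p : ℤ) • xhat) ++ (L p (u + (2 ^ p : ℤ) • yhat)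
        ++ L p (u + (2 ^ p : ℤ) • zhat)))

noncomputable def S (l : List (Fin 3 → ℤ)) : V3 := (l.map δ).sum

lemma S_append (l m : List (Fin 3 → ℤ)) : S (l ++ m) = S l + S m := by simp [S]

lemma add_self (f : V3) : f + f = 0 := by
  ext v; simpa using CharTwo.add_self_eq_zero (f v)

lemma sig_add (f g : V3) : σmap (f + g) = σmap f + σmap g := by
  simp only [σmap, Finsupp.mapDomain_add]; abel

lemma sig_zero : σmap 0 = 0 := by simp [σmap]

lemma sig_δ (u : Fin 3 → ℤ) : σmap (δ u) = δ u + δ (u + xhat) + δ (u + yhat) + δ (u + zhat) := by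
  simp [σmap, δ, Finsupp.mapDomain_single]

lemma L_length (p : ℕ) (u : Fin 3 → ℤ) : (L p u).length = 4 ^ p := by
  induction p generalizing u with
  | zero => simp [L]
  | succ p ih => simp [L, ih]; ring

lemma S_L (p : ℕ) (u : Fin 3 → ℤ) : S (L p u) = e p u := by
  induction p generalizing u with
  | zero => simp [L, S, e]
  | succ p ih => simp only [L, S_append, ih, e]; abel

lemma L_bd (p : ℕ) (u w : Fin 3 → ℤ) (h : w ∈ L p u) (i : Fin 3) :
    u i ≤ w i ∧ w i < u i + 2 ^ p := by
  induction p generalizing u with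
  | zero => simp [L] at h; subst h; simp
  | succ p ih =>
    have h2 : (0 : ℤ) < 2 ^ p := by positivity
    have h3 : (2 : ℤ) ^ (p + 1) = 2 ^ p + 2 ^ p := by ring
    simp only [L, List.mem_append] at h
    rcases h with h | h | h | h <;> have := ih _ h <;> fin_cases i <;>
      simp [xhat, yhat, zhat] at this ⊢ <;> omega

lemma L_nodup (p : ℕ) (u : Fin 3 → ℤ) : (L p u).Nodup := by
  induction p generalizing u with
  | zero => simp [L]
  | succ p ih =>
    simp only [L, List.nodup_append', ih, true_and, List.disjoint_append_right]
    have h2 : (0 : ℤ) < 2 ^ p := by positivity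
    refine ⟨⟨?_, ?_, ?_⟩, ?_, ?_, ?_⟩ <;> intro w h1 h2 <;>
      have a0 := L_bd _ _ _ h1 0 <;> have a1 := L_bd _ _ _ h1 1 <;>
      have a2 := L_bd _ _ _ h1 2 <;> have b0 := L_bd _ _ _ h2 0 <;>
      have b1 := L_bd _ _ _ h2 1 <;> have b2 := L_bd _ _ _ h2 2 <;>
      simp [xhat, yhat, zhat] at a0 a1 a2 b0 b1 b2 <;> omega

lemma S_apply (l : List (Fin 3 → ℤ)) (v : Fin 3 → ℤ) : S l v = (l.count v : ZMod 2) := by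
  induction l with
  | nil => simp [S]
  | cons a l ih =>
    have : S (a :: l) = δ a + S l := by simp [S]
    rw [this, Finsupp.add_apply, ih, List.count_cons, δ, Finsupp.single_apply]
    by_cases h : a = v <;> simp [h, add_comm]

lemma mem_supp (p : ℕ) (u v : Fin 3 → ℤ) : v ∈ (e p u).support ↔ v ∈ L p u := by
  rw [Finsupp.mem_support_iff, ← S_L, S_apply]
  by_cases h : v ∈ L p u
  · simp [List.count_eq_one_of_mem (L_nodup p u) h, h]
  · simp [List.count_eq_zero_of_not_mem h, h]

lemma sq (p : ℕ) (w : Fin 3 → ℤ) : (2 ^ (p + 1) : ℤ) • w = (2 ^ p : ℤ) • w + (2 ^ p : ℤ) • w := by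
  rw [← add_smul]; congr 1; ring

lemma sig_L (p : ℕ) (u : Fin 3 → ℤ) : σmap (S (L p u)) = pyr p u := by
  induction p generalizing u with
  | zero => simp [L, S, pyr, sig_δ]
  | succ p ih =>
    simp only [L, S_append, sig_add, ih, pyr, sq]
    generalize (2 ^ p : ℤ) • xhat = a
    generalize (2 ^ p : ℤ) • yhat = b
    generalize (2 ^ p : ℤ) • zhat = c
    rw [add_right_comm u b a, add_right_comm u c a, add_right_comm u c b]
    simp only [← add_assoc]
    ext v
    simp only [Finsupp.add_apply]
    have h : ∀ x : ZMod 2, x + x = 0 := CharTwo.add_self_eq_zero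
    linear_combination h (δ (u + a) v) + h (δ (u + b) v) + h (δ (u + c) v)
      + h (δ (u + a + b) v) + h (δ (u + a + c) v) + h (δ (u + b + c) v)

lemma N_add (f g : V3) : (f + g).support.card ≤ f.support.card + g.support.card :=
  (Finset.card_le_card Finsupp.support_add).trans (Finset.card_union_le _ _)

lemma N_δ (a : Fin 3 → ℤ) : (δ a).support.card ≤ 1 := by
  simpa [δ] using Finset.card_le_card (Finsupp.support_single_subset (a := a) (b := (1 : ZMod 2)))

lemma zmod_ne (x : ZMod 2) (h : x ≠ 0) : x = 1 := by revert x; decide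

lemma N_erase (D : V3) (a : Fin 3 → ℤ) (h : D a ≠ 0) :
    (D + δ a).support.card + 1 ≤ D.support.card := by
  have : D + δ a = D.erase a := by
    ext v
    by_cases hv : v = a
    · subst hv
      simp [δ, zmod_ne _ h]; decide
    · simp [δ, Finsupp.erase_ne hv, Finsupp.single_eq_of_ne hv]
  rw [this, Finsupp.support_erase, Finset.card_erase_add_one (by simpa using h)]

lemma N_main (C D : V3) (a : Fin 3 → ℤ) (M : ℕ) (hC : (C + δ a).support.card ≤ 5)
    (h : D a ≠ 0) (hD : D.support.card ≤ M) : (C + D).support.card ≤ M + 4 := by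
  have h1 : C + D = (C + δ a) + (D + δ a) := by
    have : (C + δ a) + (D + δ a) = C + D + (δ a + δ a) := by abel
    rw [this, add_self, add_zero]
  rw [h1]
  have := N_add (C + δ a) (D + δ a)
  have := N_erase D a h
  omega

lemma N5 (a b c d f : Fin 3 → ℤ) : (δ a + δ b + δ c + δ d + δ f).support.card ≤ 5 := by
  have h1 := N_add (δ a + δ b + δ c + δ d) (δ f)
  have h2 := N_add (δ a + δ b + δ c) (δ d)
  have h3 := N_add (δ a + δ b) (δ c)
  have h4 := N_add (δ a) (δ b)
  have := N_δ a
  have := N_δ b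
  have := N_δ c
  have := N_δ d
  have := N_δ f
  omega

lemma N3 (a b c : Fin 3 → ℤ) : (δ a + δ b + δ c).support.card ≤ 5 := by
  have h3 := N_add (δ a + δ b) (δ c)
  have h4 := N_add (δ a) (δ b)
  have := N_δ a
  have := N_δ b
  have := N_δ c
  omega

lemma δ_ne (a v : Fin 3 → ℤ) (h : v ≠ a) : δ a v = 0 := by
  simp [δ, Finsupp.single_eq_of_ne h]

lemma sig_apex_zero (l : List (Fin 3 → ℤ)) (u : Fin 3 → ℤ)
    (h : ∀ w ∈ l, u 0 + u 1 + u 2 < w 0 + w 1 + w 2) : σmap (S l) u = 0 := by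
  induction l with
  | nil => simp [S, sig_zero]
  | cons a l ih =>
    have e1 : S (a :: l) = δ a + S l := by simp [S]
    have ha := h a (by simp)
    rw [e1, sig_add, Finsupp.add_apply, ih (fun w hw => h w (by simp [hw])), sig_δ]
    simp only [Finsupp.add_apply]
    rw [δ_ne, δ_ne, δ_ne, δ_ne] <;> try simp
    all_goals
      rintro rfl
      simp [xhat, yhat, zhat] at ha
      try omega

lemma pre_cases {α : Type*} (l A B : List α) (h : l <+: A ++ B) :
    l <+: A ∨ ∃ m, l = A ++ m ∧ m <+: B ∧ m ≠ [] := by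
  obtain ⟨r, hr⟩ := h
  rcases List.append_eq_append_iff.1 hr with ⟨s, h1, h2⟩ | ⟨s, h1, h2⟩
  · exact Or.inl ⟨s, h1.symm⟩
  · by_cases hs : s = []
    · subst hs; left; simp [h1]
    · exact Or.inr ⟨s, h1, ⟨r, h2.symm⟩, hs⟩

lemma L_ne (p : ℕ) (u : Fin 3 → ℤ) : L p u ≠ [] := by
  intro h
  have := L_length p u
  rw [h] at this
  simp at this
  exact absurd this.symm (by positivity)

lemma main_aux (p : ℕ) (u : Fin 3 → ℤ) (l : List (Fin 3 → ℤ)) (hl : l <+: L p u) (hne : l ≠ []) :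
    (σmap (S l)).support.card ≤ 4 * p + 4 ∧ σmap (S l) u ≠ 0 := by
  induction p generalizing u l with
  | zero =>
    have : l = [u] := by
      rcases List.prefix_cons_iff.1 hl with h | ⟨t, rfl, h⟩
      · exact absurd h hne
      · simp at h; simp [h]
    subst this
    have e1 : S [u] = δ u := by simp [S]
    rw [e1, sig_δ]
    constructor
    · have h2 := N_add (δ u + δ (u + xhat) + δ (u + yhat)) (δ (u + zhat))
      have h3 := N_add (δ u + δ (u + xhat)) (δ (u + yhat))
      have h4 := N_add (δ u) (δ (u + xhat))
      have := N_δ u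
      have := N_δ (u + xhat)
      have := N_δ (u + yhat)
      have := N_δ (u + zhat)
      omega
    · simp only [Finsupp.add_apply]
      rw [δ_ne (u + xhat), δ_ne (u + yhat), δ_ne (u + zhat)]
      · simp [δ]
      · intro h; simpa [zhat] using congrFun h 2
      · intro h; simpa [yhat] using congrFun h 1
      · intro h; simpa [xhat] using congrFun h 0
  | succ p ih =>
    have hp : (0 : ℤ) < 2 ^ p := by positivity
    have key : ∀ m, m <+: (L p (u + (2 ^ p : ℤ) • xhat) ++ (L p (u + (2 ^ p : ℤ) • yhat)
        ++ L p (u + (2 ^ p : ℤ) • zhat))) → σmap (S (L p u ++ m)) u ≠ 0 := by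
      intro m hm
      rw [S_append, sig_add, Finsupp.add_apply, sig_apex_zero m u, add_zero]
      · exact (ih u _ List.prefix_rfl (L_ne p u)).2
      · intro w hw
        have hw := hm.subset hw
        simp only [List.mem_append] at hw
        rcases hw with h | h | h <;>
          have b0 := L_bd _ _ _ h 0 <;>
          have b1 := L_bd _ _ _ h 1 <;> have b2 := L_bd _ _ _ h 2 <;>
          simp [xhat, yhat, zhat] at b0 b1 b2 <;> omega
    have h : ∀ x : ZMod 2, x + x = 0 := CharTwo.add_self_eq_zero
    rw [L] at hl
    rcases pre_cases _ _ _ hl with hl | ⟨m, rfl, hm, hm0⟩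
    · have := ih u l hl hne
      exact ⟨by omega, this.2⟩
    refine ⟨?_, key m hm⟩
    rw [S_append, sig_add, sig_L]
    have e4 : 4 * (p + 1) + 4 = 4 * p + 4 + 4 := by ring
    rw [e4]
    rcases pre_cases _ _ _ hm with hm | ⟨m, rfl, hm, hm0⟩
    · obtain ⟨i1, i2⟩ := ih _ m hm hm0
      refine N_main _ _ _ _ ?_ i2 i1
      rw [pyr]
      generalize (2 ^ p : ℤ) • xhat = a
      generalize (2 ^ p : ℤ) • yhat = b
      generalize (2 ^ p : ℤ) • zhat = c
      convert N3 u (u + b) (u + c) using 3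
      ext v
      simp only [Finsupp.add_apply]
      linear_combination h (δ (u + a) v)
    rw [S_append, sig_add, sig_L, ← add_assoc]
    rcases pre_cases _ _ _ hm with hm | ⟨m, rfl, hm, hm0⟩
    · obtain ⟨i1, i2⟩ := ih _ m hm hm0
      refine N_main _ _ _ _ ?_ i2 i1
      rw [pyr, pyr]
      generalize (2 ^ p : ℤ) • xhat = a
      generalize (2 ^ p : ℤ) • yhat = b
      generalize (2 ^ p : ℤ) • zhat = c
      convert N5 u (u + c) (u + a + a) (u + a + b) (u + a + c) using 3
      ext v
      simp only [Finsupp.add_apply]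
      linear_combination h (δ (u + a) v) + h (δ (u + b) v)
    rw [S_append, sig_add, sig_L, ← add_assoc]
    obtain ⟨i1, i2⟩ := ih _ m hm hm0
    refine N_main _ _ _ _ ?_ i2 i1
    rw [pyr, pyr, pyr]
    generalize (2 ^ p : ℤ) • xhat = a
    generalize (2 ^ p : ℤ) • yhat = b
    generalize (2 ^ p : ℤ) • zhat = c
    rw [add_right_comm u b a]
    convert N5 u (u + a + a) (u + a + c) (u + b + b) (u + b + c) using 3
    ext v
    simp only [Finsupp.add_apply]
    linear_combination h (δ (u + a) v) + h (δ (u + b) v) + h (δ (u + c) v) + h (δ (u + a + b) v)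

lemma S_take (l : List (Fin 3 → ℤ)) (k : ℕ) (hk : k ≤ l.length) :
    S (l.take k) = ∑ i ∈ Finset.range k, δ (l.getD i 0) := by
  induction k with
  | zero => simp [S]
  | succ k ih =>
    have hk' : k < l.length := hk
    rw [Finset.sum_range_succ, ← ih hk'.le, List.take_succ_eq_append_getElem hk', S_append,
      List.getD_eq_getElem _ _ hk']
    simp [S]

/-- For every `u ∈ ℤ³` and `p ≥ 0` there is an enumeration
`u₁, …, u_{4ᵖ}` of the support of `e⁽ᵖ⁾_u` such that every partial sum
`f_t = δ_{u₁} + ⋯ + δ_{u_t}` has a syndrome `σ(f_t)` with at most `4p + 4`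
defects, one of which sits at the apex `u`: the level-`p` pyramid can be built
from the vacuum by single-qubit errors while never having more than `4p + 4`
defects, with a defect present at the apex after every step. -/
theorem pyramid_energy_barrier (u : Fin 3 → ℤ) (p : ℕ) :
    ∃ g : Fin (4 ^ p) → (Fin 3 → ℤ),
      Function.Injective g ∧
      (∀ v, v ∈ (e p u).support ↔ ∃ i, g i = v) ∧
      ∀ t : Fin (4 ^ p),
        (σmap (∑ i : Fin (4 ^ p), if i ≤ t then δ (g i) else 0)).support.card ≤ 4 * p + 4 ∧
        u ∈ (σmap (∑ i : Fin (4 ^ p), if i ≤ t then δ (g i) else 0)).support := by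
  have hlen := L_length p u
  refine ⟨fun i => (L p u).getD i 0, ?_, ?_, ?_⟩
  · intro i j hij
    have hi : (i : ℕ) < (L p u).length := by rw [hlen]; exact i.2
    have hj : (j : ℕ) < (L p u).length := by rw [hlen]; exact j.2
    simp only [List.getD_eq_getElem _ _ hi, List.getD_eq_getElem _ _ hj] at hij
    exact Fin.ext ((L_nodup p u).getElem_inj_iff.1 hij)
  · intro v
    rw [mem_supp, List.mem_iff_getElem]
    constructor
    · rintro ⟨i, hi, rfl⟩
      exact ⟨⟨i, hlen ▸ hi⟩, List.getD_eq_getElem _ _ hi⟩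
    · rintro ⟨i, rfl⟩
      have hi : (i : ℕ) < (L p u).length := by rw [hlen]; exact i.2
      exact ⟨i, hi, (List.getD_eq_getElem _ _ hi).symm⟩
  · intro t
    have ht := t.2
    have hs : (∑ i : Fin (4 ^ p), if i ≤ t then δ ((L p u).getD i 0) else 0)
        = S ((L p u).take (t + 1)) := by
      rw [S_take _ _ (by rw [hlen]; exact ht)]
      simp only [Fin.le_def]
      rw [Fin.sum_univ_eq_sum_range
        (fun i => if i ≤ (t : ℕ) then δ ((L p u).getD i 0) else 0) (4 ^ p),
        ← Finset.sum_filter]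
      congr 1
      ext i
      simp
      omega
    rw [hs, Finsupp.mem_support_iff]
    refine main_aux p u _ ⟨_, List.take_append_drop _ _⟩ ?_
    intro h
    have := congrArg List.length h
    simp [hlen] at this

end BH
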